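/- arXiv:2402.02083 — 3 statements merged into one kernel-verified Lean document; each statement's English description precedes it below -/
import Mathlib

section
/- Let G be a finite simple graph containing a vertex v of degree 9 with distinct neighbors u_1, …, u_9 such that u_i u_{i+1} ∈ E(G) for i = 1, …, 8 and u_9 u_1 ∈ E(G) (so {v, u_1, …, u_9} is a 9-wheel with hub v). Suppose d(u_1) = d(u_3) = d(u_5) = 3, d(u_7) ≤ 5, and {u_1, u_3, u_5, u_7} is an independent set in G. Then there exists a set B of at most 8 edges of G such that γ_i(G − B) > γ_i(G); that is, b_i(G) ≤ 8. -/
open scoped BigOperators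

/-- A set of vertices is an independent dominating set: it is independent
(no two of its vertices are adjacent) and dominating (every vertex is in it
or adjacent to a vertex in it). -/
def SimpleGraph.IsIndepDomSet {V : Type*} (G : SimpleGraph V) (S : Set V) : Prop :=
  (∀ u ∈ S, ∀ w ∈ S, ¬ G.Adj u w) ∧ ∀ x, x ∈ S ∨ ∃ u ∈ S, G.Adj u x

/-- The independent domination number: the minimum cardinality of an
independent dominating set. -/
noncomputable def SimpleGraph.indepDomNum {V : Type*} (G : SimpleGraph V) : ℕ :=
  sInf {n | ∃ S : Set V, G.IsIndepDomSet S ∧ S.ncard = n}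


namespace SimpleGraph

variable {V : Type*} [Finite V] (G : SimpleGraph V)

/-- An independent set extends to an independent dominating set by adding only vertices that it
does not already dominate. -/
theorem exists_isIndepDomSet_superset {T : Set V} (hT : ∀ x ∈ T, ∀ y ∈ T, ¬ G.Adj x y) :
    ∃ S, G.IsIndepDomSet S ∧ T ⊆ S ∧ ∀ x ∈ S, x ∈ T ∨ ∀ y ∈ T, ¬ G.Adj y x := by
  obtain ⟨S, hTS, hS⟩ :=
    (Set.toFinite {S : Set V | ∀ x ∈ S, ∀ y ∈ S, ¬ G.Adj x y}).exists_le_maximal hT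
  refine ⟨S, ⟨hS.prop, fun x => ?_⟩, hTS, fun x hx => Or.inr fun y hy => hS.prop y (hTS hy) x hx⟩
  by_contra! hx
  refine hx.1 (hS.le_of_ge (y := insert x S) ?_ (Set.subset_insert x S) (Set.mem_insert x S))
  rintro y (rfl | hy) z (rfl | hz) h
  · exact G.loopless.irrefl _ h
  · exact hx.2 z hz h.symm
  · exact hx.2 y hy h
  · exact hS.prop y hy z hz h

/-- The independent domination number is attained. -/
theorem exists_isIndepDomSet_ncard_eq_indepDomNum :
    ∃ S, G.IsIndepDomSet S ∧ S.ncard = G.indepDomNum := by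
  obtain ⟨S, hS, -⟩ := G.exists_isIndepDomSet_superset (T := ∅) (by simp)
  exact Nat.sInf_mem (s := {n | ∃ S : Set V, G.IsIndepDomSet S ∧ S.ncard = n}) ⟨_, S, hS, rfl⟩

/-- An independent set together with a set containing all the vertices it does not dominate
bounds the independent domination number. -/
theorem indepDomNum_le_ncard_add {T : Set V} (U : Set V)
    (hT : ∀ x ∈ T, ∀ y ∈ T, ¬ G.Adj x y) (hU : ∀ x, x ∈ T ∨ (∃ y ∈ T, G.Adj y x) ∨ x ∈ U) :
    G.indepDomNum ≤ T.ncard + U.ncard := by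
  obtain ⟨S, hS, -, h⟩ := G.exists_isIndepDomSet_superset hT
  have hsub : S ⊆ T ∪ U := fun x hx => by
    rcases hU x with hx' | ⟨y, hy, hyx⟩ | hx'
    · exact Or.inl hx'
    · exact (h x hx).elim Or.inl fun h' => absurd hyx (h' y hy)
    · exact Or.inr hx'
  refine le_trans (Nat.sInf_le (m := S.ncard) ⟨S, hS, rfl⟩)
    ((Set.ncard_le_ncard hsub).trans (Set.ncard_union_le T U))

variable {G}

set_option maxHeartbeats 1000000 in
/-- Let `v` be a vertex of degree 9 that is the hub of a wheel with rim `a p b q c r d s t`, where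
`a`, `b`, `c` have degree 3 and `d` has degree at most 5. Deleting all edges at `b`, all edges at
`d` except `v d`, and the edge `a t` increases the independent domination number. -/
theorem indepDomNum_lt_of_wheel {H : SimpleGraph V} {v a b c d p q r s t : V}
    (hne : [v, a, p, b, q, c, r, d, s, t].Nodup)
    (hv : ∀ x, G.Adj v x ↔ x ∈ [a, p, b, q, c, r, d, s, t])
    (ha : ∀ x, G.Adj a x ↔ x = v ∨ x = p ∨ x = t)
    (hb : ∀ x, G.Adj b x ↔ x = v ∨ x = p ∨ x = q)
    (hc : ∀ x, G.Adj c x ↔ x = v ∨ x = q ∨ x = r)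
    (hdr : G.Adj d r) (hds : G.Adj d s) (hd : (G.neighborSet d).ncard ≤ 5)
    (hH : ∀ x y, H.Adj x y ↔ G.Adj x y ∧ x ≠ b ∧ y ≠ b ∧ (x = d → y = v) ∧ (y = d → x = v) ∧
      ¬ (x = a ∧ y = t) ∧ ¬ (x = t ∧ y = a)) :
    G.indepDomNum < H.indepDomNum := by
  obtain ⟨S, ⟨hSi, hSd⟩, hcard⟩ := H.exists_isIndepDomSet_ncard_eq_indepDomNum
  rw [← hcard]
  simp only [List.nodup_cons, List.mem_cons, List.not_mem_nil, or_false, not_or] at hne hv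
  have hsymm : ∀ x y, G.Adj x y → G.Adj y x := fun x y h => h.symm
  have hbS : b ∈ S := by
    have := hSd b
    grind
  have hle : ∀ {T U : Set V}, T.ncard + U.ncard < S.ncard →
      (∀ x ∈ T, ∀ y ∈ T, ¬ G.Adj x y) → (∀ x, x ∈ T ∨ (∃ y ∈ T, G.Adj y x) ∨ x ∈ U) →
      G.indepDomNum < S.ncard :=
    fun {T U} h h₁ h₂ => (G.indepDomNum_le_ncard_add U h₁ h₂).trans_lt h
  by_cases hvS : v ∈ S
  · refine hle (T := S \ {b}) (U := ∅) ?_ ?_ ?_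
    · simpa using Set.ncard_sdiff_singleton_lt_of_mem hbS
    · intro x hx y hy hxy
      have := hSi x hx.1 y hy.1
      have := hSi v hvS x hx.1
      have := hSi v hvS y hy.1
      grind
    · intro x
      have := hSd x
      grind
  have hdS : d ∈ S := by
    have := hSd d
    grind
  -- `b` and `d` are dropped when they conflict with `S`, and so is `a` when `a` and `t` conflict.
  let D : Set V := {x | x ∈ S ∧ ((x = b ∨ x = d) ∧ (∃ y ∈ S, G.Adj x y) ∨ x = a ∧ t ∈ S)}
  have hDS : D ⊆ S := fun x hx => hx.1
  have hind : ∀ x ∈ S \ D, ∀ y ∈ S \ D, ¬ G.Adj x y := by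
    rintro x ⟨hx, hx'⟩ y ⟨hy, hy'⟩ hxy
    have := hSi x hx y hy
    have : ¬ ((x = b ∨ x = d) ∧ (∃ y ∈ S, G.Adj x y) ∨ x = a ∧ t ∈ S) := fun h => hx' ⟨hx, h⟩
    have : ¬ ((y = b ∨ y = d) ∧ (∃ z ∈ S, G.Adj y z) ∨ y = a ∧ t ∈ S) := fun h => hy' ⟨hy, h⟩
    grind
  have hcardD := Set.ncard_sdiff_add_ncard_of_subset hDS
  have hmem : ∀ x, x ∈ D ↔ x ∈ S ∧ ((x = b ∨ x = d) ∧ (∃ y ∈ S, G.Adj x y) ∨ x = a ∧ t ∈ S) :=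
    fun x => Iff.rfl
  clear_value D
  rcases D.eq_empty_or_nonempty with hD | hD
  · have hat : ¬ (a ∈ S ∧ t ∈ S) := by grind
    have hbN : ∀ y ∈ S, ¬ G.Adj b y := by grind
    have hdN : ∀ y ∈ S, ¬ G.Adj d y := by grind
    have hcS : c ∈ S := by
      have := hSd c
      grind
    have haS : a ∈ S := by
      have := hSd a
      grind
    have hsub : ({a, b, c, d} : Set V) ⊆ S := by
      rintro x (rfl | rfl | rfl | rfl) <;> assumption
    have hUsub : ({v, r, s} : Set V) ⊆ G.neighborSet d := by
      rintro x (rfl | rfl | rfl)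
      · exact ((hv d).2 (by simp)).symm
      · exact hdr
      · exact hds
    refine hle (T := insert v (S \ {a, b, c, d})) (U := G.neighborSet d \ {v, r, s}) ?_ ?_ ?_
    · have h₁ := Set.ncard_insert_le v (S \ {a, b, c, d})
      have h₂ := Set.ncard_sdiff_add_ncard_of_subset hsub
      have h₃ := Set.ncard_sdiff_add_ncard_of_subset hUsub
      have h₄ : ({a, b, c, d} : Set V).ncard = 4 := by
        rw [Set.ncard_eq_succ (Set.toFinite _)]
        refine ⟨a, {b, c, d}, by simp; grind, rfl, ?_⟩
        rw [Set.ncard_eq_three]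
        exact ⟨b, c, d, by grind⟩
      have h₅ : ({v, r, s} : Set V).ncard = 3 := by
        rw [Set.ncard_eq_three]
        exact ⟨v, r, s, by grind⟩
      omega
    · have hvN : ∀ x ∈ S \ {a, b, c, d}, ¬ G.Adj v x := by
        rintro x ⟨hx, hx'⟩ h
        simp only [Set.mem_insert_iff, Set.mem_singleton_iff, not_or] at hx'
        have := (hv x).1 h
        grind
      have hSN : ∀ x ∈ S \ {a, b, c, d}, ∀ y ∈ S \ {a, b, c, d}, ¬ G.Adj x y := by
        intro x hx y hy
        exact hind x ⟨hx.1, by simp [hD]⟩ y ⟨hy.1, by simp [hD]⟩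
      rintro x (rfl | hx) y (rfl | hy)
      · exact G.loopless.irrefl _
      · exact hvN y hy
      · exact fun h => hvN x hx h.symm
      · exact hSN x hx y hy
    · intro x
      have := hSd x
      simp only [Set.mem_insert_iff, Set.mem_sdiff, Set.mem_singleton_iff, mem_neighborSet]
      grind
  · have hDabd : ∀ x ∈ D, x = a ∨ x = b ∨ x = d := by
      intro x hx
      have := (hmem x).1 hx
      tauto
    have hndom : ∀ x, G.Adj b x ∨ G.Adj d x ∨ x = t → x ∈ S → x ∈ S \ D := by
      refine fun x h hx => ⟨hx, fun hxD => ?_⟩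
      have hx' := hDabd x hxD
      have := ha d
      have := hb d
      have := hb x
      have := hsymm d x
      have : ¬ G.Adj d d := G.loopless.irrefl d
      clear hmem hind hle hSd hSi hH hDabd hsymm ha hb hc hv
      grind
    have hb' (h : b ∈ D) : ∃ y ∈ S \ D, G.Adj b y := by
      rcases ((hmem b).1 h).2 with ⟨-, y, hy, hby⟩ | ⟨h', -⟩
      · exact ⟨y, hndom y (Or.inl hby) hy, hby⟩
      · grind only
    have hd' (h : d ∈ D) : ∃ y ∈ S \ D, G.Adj d y := by
      rcases ((hmem d).1 h).2 with ⟨-, y, hy, hdy⟩ | ⟨h', -⟩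
      · exact ⟨y, hndom y (Or.inr (Or.inl hdy)) hy, hdy⟩
      · grind only
    have ha' (h : a ∈ D) : ∃ y ∈ S \ D, G.Adj a y := by
      rcases ((hmem a).1 h).2 with ⟨h' | h', -⟩ | ⟨-, ht⟩
      · grind only
      · grind only
      · exact ⟨t, hndom t (by simp) ht, (ha t).2 (by simp)⟩
    have hv' : ∃ y ∈ S \ D, G.Adj y v := by
      by_cases h : b ∈ D
      · obtain ⟨y, hy, hby⟩ := hb' h
        have hyv : y ≠ v := by
          rintro rfl
          exact hvS hy.1
        exact ⟨y, hy, ((hv y).2 (by have := (hb y).1 hby; tauto)).symm⟩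
      · exact ⟨b, ⟨hbS, h⟩, (hb v).2 (Or.inl rfl)⟩
    have hdom : ∀ x, x ∈ S \ D ∨ (∃ y ∈ S \ D, G.Adj y x) ∨ x = p ∧ a ∈ D ∧ b ∈ D := by
      intro x
      by_cases hxD : x ∈ D
      · right; left
        rcases hDabd x hxD with rfl | rfl | rfl
        · exact (ha' hxD).imp fun y h => ⟨h.1, h.2.symm⟩
        · exact (hb' hxD).imp fun y h => ⟨h.1, h.2.symm⟩
        · exact (hd' hxD).imp fun y h => ⟨h.1, h.2.symm⟩
      · rcases hSd x with hx | ⟨y, hy, hyx⟩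
        · exact Or.inl ⟨hx, hxD⟩
        · rw [hH] at hyx
          by_cases hyD : y ∈ D
          · rcases hDabd y hyD with rfl | rfl | rfl
            · rcases (ha x).1 hyx.1 with rfl | rfl | rfl
              · exact Or.inr (Or.inl hv')
              · by_cases hbD : b ∈ D
                · exact Or.inr (Or.inr ⟨rfl, hyD, hbD⟩)
                · exact Or.inr (Or.inl ⟨b, ⟨hbS, hbD⟩, (hb x).2 (by simp)⟩)
              · simp at hyx
            · exact absurd rfl hyx.2.1
            · rw [hyx.2.2.2.1 rfl]
              exact Or.inr (Or.inl hv')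
          · exact Or.inr (Or.inl ⟨y, ⟨hy, hyD⟩, hyx.1⟩)
    by_cases hab : a ∈ D ∧ b ∈ D
    · refine hle (T := S \ D) (U := {p}) ?_ hind
        fun x => (hdom x).imp_right (Or.imp_right And.left)
      have : 1 < D.ncard := (Set.one_lt_ncard).2 ⟨a, hab.1, b, hab.2, by grind⟩
      rw [Set.ncard_singleton]
      omega
    · refine hle (T := S \ D) (U := ∅) ?_ hind
        fun x => (hdom x).imp_right (Or.imp_right fun h => absurd h.2 hab)
      have := (Set.ncard_pos).2 hD
      rw [Set.ncard_empty]
      omega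

end SimpleGraph

theorem stmt5 {V : Type*} [Fintype V]
    (G : SimpleGraph V) (v : V) (u : Fin 9 → V)
    (hinj : Function.Injective u)
    (hdeg : (G.neighborSet v).ncard = 9)
    (hnbr : ∀ i, G.Adj v (u i))
    (hcyc : ∀ i : Fin 9, i.val < 8 → G.Adj (u i) (u (i + 1)))
    (hlast : G.Adj (u 8) (u 0))
    (hd1 : (G.neighborSet (u 0)).ncard = 3)
    (hd3 : (G.neighborSet (u 2)).ncard = 3)
    (hd5 : (G.neighborSet (u 4)).ncard = 3)
    (hd7 : (G.neighborSet (u 6)).ncard ≤ 5)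
    (hind : ∀ i ∈ ({0, 2, 4, 6} : Finset (Fin 9)),
      ∀ j ∈ ({0, 2, 4, 6} : Finset (Fin 9)), ¬ G.Adj (u i) (u j)) :
    ∃ B : Finset (Sym2 V), ↑B ⊆ G.edgeSet ∧ B.card ≤ 8 ∧
      G.indepDomNum < (G.deleteEdges ↑B).indepDomNum := by
  classical
  have hv : G.neighborSet v = Set.range u := by
    have hsub : Set.range u ⊆ G.neighborSet v := Set.range_subset_iff.2 hnbr
    refine (Set.eq_of_subset_of_ncard_le hsub ?_).symm
    rw [← Set.image_univ, Set.ncard_image_of_injective _ hinj]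
    simpa using hdeg.le
  have hvu : ∀ i, v ≠ u i := fun i => (hnbr i).ne
  have hu : ∀ i j, u i = u j ↔ i = j := fun i j => hinj.eq_iff
  have hN : ∀ i j k, (G.neighborSet (u i)).ncard = 3 → j ≠ k → G.Adj (u i) (u j) →
      G.Adj (u i) (u k) → ∀ x, G.Adj (u i) x ↔ x = v ∨ x = u j ∨ x = u k := by
    intro i j k hi hjk hj hk x
    have h : ({v, u j, u k} : Set V) = G.neighborSet (u i) := by
      refine Set.eq_of_subset_of_ncard_le ?_ ?_
      · rintro x (rfl | rfl | rfl)
        exacts [(hnbr i).symm, hj, hk]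
      · rw [hi, Set.ncard_eq_three.2 ⟨v, u j, u k, hvu j, hvu k, hinj.ne hjk, rfl⟩]
    rw [← SimpleGraph.mem_neighborSet, ← h]
    rfl
  let B : Finset (Sym2 V) := (G.neighborSet (u 2)).toFinset.image (fun x => s(u 2, x)) ∪
    ((G.neighborSet (u 6)).toFinset.erase v).image (fun x => s(u 6, x)) ∪ {s(u 0, u 8)}
  refine ⟨B, ?_, ?_, ?_⟩
  · intro e he
    simp only [B, Finset.coe_union, Finset.coe_image, Finset.coe_singleton, Set.coe_toFinset,
      Finset.coe_erase] at he
    rcases he with (⟨x, hx, rfl⟩ | ⟨x, hx, rfl⟩) | rfl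
    exacts [hx, hx.1, hlast.symm]
  · have h₁ : (G.neighborSet (u 2)).toFinset.card = 3 := by
      rw [← Set.ncard_eq_toFinset_card', hd3]
    have h₂ : ((G.neighborSet (u 6)).toFinset.erase v).card ≤ 4 := by
      rw [Finset.card_erase_of_mem (by simpa using (hnbr 6).symm), ← Set.ncard_eq_toFinset_card']
      omega
    exact (Finset.card_union_le _ _).trans (Nat.add_le_add ((Finset.card_union_le _ _).trans
      (Nat.add_le_add (Finset.card_image_le.trans h₁.le) (Finset.card_image_le.trans h₂)))
      (Finset.card_singleton _).le)
  · refine SimpleGraph.indepDomNum_lt_of_wheel (v := v) (a := u 0) (p := u 1) (b := u 2)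
      (q := u 3) (c := u 4) (r := u 5) (d := u 6) (s := u 7) (t := u 8) ?_ ?_
      (hN 0 1 8 hd1 (by decide) (hcyc 0 (by decide)) hlast.symm)
      (hN 2 1 3 hd3 (by decide) (hcyc 1 (by decide)).symm (hcyc 2 (by decide)))
      (hN 4 3 5 hd5 (by decide) (hcyc 3 (by decide)).symm (hcyc 4 (by decide)))
      (hcyc 5 (by decide)).symm (hcyc 6 (by decide)) hd7 ?_
    · simp [hvu, hu]
    · intro x
      rw [← SimpleGraph.mem_neighborSet, hv]
      simp [Fin.exists_fin_succ, eq_comm]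
    · intro x y
      rw [SimpleGraph.deleteEdges_adj]
      refine and_congr_right fun hxy => ?_
      have hyx := hxy.symm
      simp only [B, Finset.coe_union, Finset.coe_image, Finset.coe_singleton, Set.coe_toFinset,
        Finset.coe_erase, Set.mem_union, Set.mem_image, Set.mem_sdiff, Set.mem_singleton_iff,
        SimpleGraph.mem_neighborSet, Sym2.eq_iff]
      clear hN hu hcyc hind hv hnbr
      grind
end

section
/- Let G be a finite simple graph containing a vertex v of degree 9 with distinct neighbors u_1, …, u_9 such that u_i u_{i+1} ∈ E(G) for i = 1, …, 8 and u_1 u_9 ∉ E(G) (so {v, u_1, …, u_9} is a 9-fan with hub v that is not a wheel). Suppose d(u_1) = d(u_3) = d(u_5) = d(u_8) = 3 and {u_1, u_3, u_5, u_8} is an independent set in G. Then there exists a set B of at most 8 edges of G such that γ_i(G − B) > γ_i(G); that is, b_i(G) ≤ 8. -/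
open scoped BigOperators

namespace SimpleGraph

variable {V : Type*}

theorem exists_isIndepDomSet [Finite V] (G : SimpleGraph V) : ∃ S, G.IsIndepDomSet S := by
  obtain ⟨S, hS⟩ := (Set.toFinite {S : Set V | ∀ a ∈ S, ∀ b ∈ S, ¬ G.Adj a b}).exists_maximal
    ⟨∅, by simp⟩
  refine ⟨S, hS.prop, fun x => ?_⟩
  by_contra! h
  refine h.1 (hS.le_of_ge (y := insert x S) ?_ (Set.subset_insert x S) (Set.mem_insert x S))
  rintro a (rfl | ha) b (rfl | hb)
  · exact G.irrefl
  · exact fun e => h.2 b hb e.symm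
  · exact h.2 a ha
  · exact hS.prop a ha b hb

theorem indepDomNum_le {G : SimpleGraph V} {S : Set V} (hS : G.IsIndepDomSet S) :
    G.indepDomNum ≤ S.ncard :=
  Nat.sInf_le ⟨S, hS, rfl⟩

theorem exists_isIndepDomSet_ncard_eq [Finite V] (G : SimpleGraph V) :
    ∃ S, G.IsIndepDomSet S ∧ S.ncard = G.indepDomNum :=
  Nat.sInf_mem (s := {n | ∃ S : Set V, G.IsIndepDomSet S ∧ S.ncard = n})
    (G.exists_isIndepDomSet.imp' Set.ncard fun S hS => ⟨S, hS, rfl⟩)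

/-- An independent set dominating everything outside an independent set `T` becomes an
independent dominating set once the undominated vertices of `T` are added. -/
theorem isIndepDomSet_union_undominated {G : SimpleGraph V} {R T : Set V}
    (hR : ∀ a ∈ R, ∀ b ∈ R, ¬ G.Adj a b) (hT : ∀ a ∈ T, ∀ b ∈ T, ¬ G.Adj a b)
    (hdom : ∀ x ∉ T, x ∈ R ∨ ∃ r ∈ R, G.Adj r x) :
    G.IsIndepDomSet (R ∪ {t ∈ T | ∀ r ∈ R, ¬ G.Adj r t}) := by
  constructor
  · rintro a (ha | ha) b (hb | hb)
    · exact hR a ha b hb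
    · exact hb.2 a ha
    · exact fun e => ha.2 b hb e.symm
    · exact hT a ha.1 b hb.1
  · intro x
    by_cases hx : x ∈ R ∨ ∃ r ∈ R, G.Adj r x
    · exact hx.imp Or.inl fun ⟨r, hr, e⟩ => ⟨r, Or.inl hr, e⟩
    · have hxT : x ∈ T := by_contra fun h => hx (hdom x h)
      push Not at hx
      exact Or.inl (Or.inr ⟨hxT, hx.2⟩)

theorem ncard_lt_of_subset_insert_diff_pair [Finite V] {S D : Set V} {b c y : V}
    (hb : b ∈ S) (hc : c ∈ S) (hbc : b ≠ c) (h : D ⊆ insert y (S \ {b, c})) :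
    D.ncard < S.ncard := by
  have h₁ := Set.ncard_le_ncard h
  have h₂ := Set.ncard_insert_le y (S \ {b, c})
  have h₃ := Set.ncard_sdiff_add_ncard_of_subset (s := {b, c}) (t := S) (by grind)
  rw [Set.ncard_pair hbc] at h₃
  omega

/-- If `H` arises from `G` by deleting edges at an independent set `T` of neighbors of `v`, so
that `c ∈ T` becomes a leaf at `w` and the other vertices of `T` become leaves at `v`, then every
independent dominating set of `H` can be improved in `G`. -/
theorem exists_isIndepDomSet_ncard_lt [Finite V] {G H : SimpleGraph V} {T : Set V}
    {v w b c : V} (hHG : H ≤ G) (hT : ∀ a ∈ T, ∀ b ∈ T, ¬ G.Adj a b)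
    (hkeep : ∀ x ∉ T, ∀ y ∉ T, G.Adj x y → H.Adj x y)
    (hb : b ∈ T) (hc : c ∈ T) (hbc : b ≠ c) (hv : v ∉ T) (hw : w ∉ T)
    (hleaf : ∀ t ∈ T, t ≠ c → ∀ x, H.Adj t x → x = v) (hcleaf : ∀ x, H.Adj c x → x = w)
    (hvT : ∀ t ∈ T, G.Adj v t) (hvw : G.Adj v w) (hwb : G.Adj w b) (hwc : G.Adj w c)
    (hnbr : ∀ r ∉ T, G.Adj v r → ∃ t ∈ T, G.Adj r t)
    {S : Set V} (hS : H.IsIndepDomSet S) :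
    ∃ D, G.IsIndepDomSet D ∧ D.ncard < S.ncard := by
  obtain ⟨hind, hdom⟩ := hS
  have hR : ∀ x ∈ S \ T, ∀ y ∈ S \ T, ¬ G.Adj x y := fun x hx y hy e =>
    hind x hx.1 y hy.1 (hkeep x hx.2 y hy.2 e)
  have hRdom : ∀ x ∉ T, x ≠ v → x ≠ w → x ∈ S \ T ∨ ∃ r ∈ S \ T, G.Adj r x := by
    intro x hx hxv hxw
    rcases hdom x with h | ⟨r, hr, e⟩
    · exact Or.inl ⟨h, hx⟩
    · refine Or.inr ⟨r, ⟨hr, fun hrT => ?_⟩, hHG e⟩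
      by_cases hrc : r = c
      · exact hxw (hcleaf x (hrc ▸ e))
      · exact hxv (hleaf r hrT hrc x e)
  have hcS : w ∉ S → c ∈ S := fun h => (hdom c).resolve_right fun ⟨r, hr, e⟩ =>
    h (hcleaf r e.symm ▸ hr)
  have hTS : v ∉ S → ∀ t ∈ T, t ≠ c → t ∈ S := fun h t ht htc =>
    (hdom t).resolve_right fun ⟨r, hr, e⟩ => h (hleaf t ht htc r e.symm ▸ hr)
  by_cases hvS : v ∈ S
  · have hwS : w ∉ S := fun h => hind v hvS w h (hkeep v hv w hw hvw)
    refine ⟨_, isIndepDomSet_union_undominated hR hT fun x hx => ?_,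
      Set.ncard_lt_ncard ⟨?_, fun h => ?_⟩⟩
    · by_cases hxv : x = v
      · exact Or.inl ⟨hxv ▸ hvS, hx⟩
      by_cases hxw : x = w
      · exact Or.inr ⟨v, ⟨hvS, hv⟩, hxw ▸ hvw⟩
      exact hRdom x hx hxv hxw
    · rintro x (hx | hx)
      · exact hx.1
      · exact absurd (hvT x hx.1) (hx.2 v ⟨hvS, hv⟩)
    · rcases h (hcS hwS) with h | h
      · exact h.2 hc
      · exact h.2 v ⟨hvS, hv⟩ (hvT c hc)
  have hbS := hTS hvS b hb hbc
  by_cases hwR : w ∈ S \ T ∨ ∃ r ∈ S \ T, G.Adj r w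
  · by_cases hvR : ∃ r ∈ S \ T, G.Adj r v
    · obtain ⟨r, hr, hrv⟩ := hvR
      obtain ⟨t, htT, htS, r, hr, hrt⟩ : ∃ t ∈ T, t ∈ S ∧ ∃ r ∈ S \ T, G.Adj r t := by
        by_cases hwS : w ∈ S
        · exact ⟨b, hb, hbS, w, ⟨hwS, hw⟩, hwb⟩
        · obtain ⟨t, ht, e⟩ := hnbr r hr.2 hrv.symm
          refine ⟨t, ht, ?_, r, hr, e⟩
          by_cases htc : t = c
          · exact htc ▸ hcS hwS
          · exact hTS hvS t ht htc
      refine ⟨_, isIndepDomSet_union_undominated hR hT fun x hx => ?_,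
        Set.ncard_lt_ncard ⟨?_, fun h => ?_⟩⟩
      · by_cases hxv : x = v
        · subst hxv
          exact Or.inr ⟨_, ‹_›, hrv⟩
        by_cases hxw : x = w
        · exact hxw ▸ hwR
        exact hRdom x hx hxv hxw
      · rintro x (hx | hx)
        · exact hx.1
        · by_cases hxc : x = c
          · rw [hxc]
            exact hcS fun hwS => hx.2 w ⟨hwS, hw⟩ (hxc ▸ hwc)
          · exact hTS hvS x hx.1 hxc
      · rcases h htS with h | h
        · exact h.2 htT
        · exact h.2 r hr hrt
    · push Not at hvR
      have hwS : w ∉ S := fun h => hvR w ⟨h, hw⟩ hvw.symm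
      refine ⟨_, isIndepDomSet_union_undominated (R := insert v (S \ T)) ?_ hT fun x hx => ?_,
        ncard_lt_of_subset_insert_diff_pair (y := v) hbS (hcS hwS) hbc ?_⟩
      · rintro x (rfl | hx) y (rfl | hy)
        · exact G.irrefl
        · exact fun e => hvR y hy e.symm
        · exact hvR x hx
        · exact hR x hx y hy
      · by_cases hxv : x = v
        · exact Or.inl (Or.inl hxv)
        by_cases hxw : x = w
        · exact Or.inr ⟨v, Or.inl rfl, hxw ▸ hvw⟩
        exact (hRdom x hx hxv hxw).imp Or.inr fun ⟨r, hr, e⟩ => ⟨r, Or.inr hr, e⟩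
      · rintro x ((rfl | hx) | hx)
        · exact Or.inl rfl
        · exact Or.inr ⟨hx.1, by rintro (rfl | rfl) <;> exact hx.2 ‹_›⟩
        · exact absurd (hvT x hx.1) (hx.2 v (Or.inl rfl))
  · push Not at hwR
    have hwS : w ∉ S := fun h => hwR.1 ⟨h, hw⟩
    refine ⟨_, isIndepDomSet_union_undominated (R := insert w (S \ T)) ?_ hT fun x hx => ?_,
      ncard_lt_of_subset_insert_diff_pair (y := w) hbS (hcS hwS) hbc ?_⟩
    · rintro x (rfl | hx) y (rfl | hy)
      · exact G.irrefl
      · exact fun e => hwR.2 y hy e.symm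
      · exact hwR.2 x hx
      · exact hR x hx y hy
    · by_cases hxw : x = w
      · exact Or.inl (Or.inl hxw)
      by_cases hxv : x = v
      · exact Or.inr ⟨w, Or.inl rfl, hxv ▸ hvw.symm⟩
      exact (hRdom x hx hxv hxw).imp Or.inr fun ⟨r, hr, e⟩ => ⟨r, Or.inr hr, e⟩
    · rintro x ((rfl | hx) | hx)
      · exact Or.inl rfl
      · exact Or.inr ⟨hx.1, by rintro (rfl | rfl) <;> exact hx.2 ‹_›⟩
      · refine Or.inr ⟨hTS hvS x hx.1 ?_, ?_⟩
        · rintro rfl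
          exact hx.2 w (Or.inl rfl) hwc
        · rintro (rfl | rfl)
          · exact hx.2 w (Or.inl rfl) hwb
          · exact hx.2 w (Or.inl rfl) hwc

/-- Two distinct neighbors of a vertex of degree three determine a third one. -/
theorem exists_third_neighbor {G : SimpleGraph V} {a x y : V}
    (h : (G.neighborSet a).ncard = 3) (hx : G.Adj a x) (hy : G.Adj a y) (hxy : x ≠ y) :
    ∃ z, G.Adj a z ∧ ∀ t, G.Adj a t → t = x ∨ t = y ∨ t = z := by
  obtain ⟨p, q, r, hpq, hpr, hqr, he⟩ := Set.ncard_eq_three.mp h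
  have key : ∀ t, G.Adj a t ↔ t = p ∨ t = q ∨ t = r := fun t => by
    rw [← mem_neighborSet, he]; simp
  rw [key] at hx hy
  simp only [key]
  have : ∃ z, z ∈ ({p, q, r} : Set V) ∧ z ≠ x ∧ z ≠ y := by
    by_cases hp : p = x ∨ p = y
    · by_cases hq : q = x ∨ q = y
      · exact ⟨r, by grind⟩
      · exact ⟨q, by grind⟩
    · exact ⟨p, by grind⟩
  obtain ⟨z, hz⟩ := this
  exact ⟨z, by grind⟩

theorem eq_or_eq_or_eq_of_adj {G : SimpleGraph V} {a x y z : V}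
    (h : (G.neighborSet a).ncard = 3) (hx : G.Adj a x) (hy : G.Adj a y) (hz : G.Adj a z)
    (hxy : x ≠ y) (hxz : x ≠ z) (hyz : y ≠ z) (t : V) (ht : G.Adj a t) :
    t = x ∨ t = y ∨ t = z := by
  obtain ⟨r, -, hr⟩ := exists_third_neighbor h hx hy hxy
  have := hr z hz
  have := hr t ht
  grind

end SimpleGraph

theorem stmt9 {V : Type*} [Fintype V]
    (G : SimpleGraph V) (v : V) (u : Fin 9 → V)
    (hinj : Function.Injective u)
    (hdeg : (G.neighborSet v).ncard = 9)
    (hnbr : ∀ i, G.Adj v (u i))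
    (hpath : ∀ i : Fin 9, i.val < 8 → G.Adj (u i) (u (i + 1)))
    (hnotwheel : ¬ G.Adj (u 0) (u 8))
    (hd1 : (G.neighborSet (u 0)).ncard = 3)
    (hd3 : (G.neighborSet (u 2)).ncard = 3)
    (hd5 : (G.neighborSet (u 4)).ncard = 3)
    (hd8 : (G.neighborSet (u 7)).ncard = 3)
    (hind : ∀ i ∈ ({0, 2, 4, 7} : Finset (Fin 9)),
      ∀ j ∈ ({0, 2, 4, 7} : Finset (Fin 9)), ¬ G.Adj (u i) (u j)) :
    ∃ B : Finset (Sym2 V), ↑B ⊆ G.edgeSet ∧ B.card ≤ 8 ∧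
      G.indepDomNum < (G.deleteEdges ↑B).indepDomNum := by
  classical
  have hne : ∀ i j : Fin 9, i ≠ j → u i ≠ u j := fun i j h e => h (hinj e)
  have hvu : ∀ i, v ≠ u i := fun i => (hnbr i).ne
  have p01 : G.Adj (u 0) (u 1) := hpath 0 (by decide)
  have p12 : G.Adj (u 1) (u 2) := hpath 1 (by decide)
  have p23 : G.Adj (u 2) (u 3) := hpath 2 (by decide)
  have p34 : G.Adj (u 3) (u 4) := hpath 3 (by decide)
  have p45 : G.Adj (u 4) (u 5) := hpath 4 (by decide)
  have p67 : G.Adj (u 6) (u 7) := hpath 6 (by decide)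
  have p78 : G.Adj (u 7) (u 8) := hpath 7 (by decide)
  obtain ⟨x, h0x, n0⟩ := SimpleGraph.exists_third_neighbor hd1 (hnbr 0).symm p01 (hvu 1)
  have n2 := SimpleGraph.eq_or_eq_or_eq_of_adj hd3 (hnbr 2).symm p12.symm p23 (hvu 1) (hvu 3)
    (hne 1 3 (by decide))
  have n4 := SimpleGraph.eq_or_eq_or_eq_of_adj hd5 (hnbr 4).symm p34.symm p45 (hvu 3) (hvu 5)
    (hne 3 5 (by decide))
  have n7 := SimpleGraph.eq_or_eq_or_eq_of_adj hd8 (hnbr 7).symm p67.symm p78 (hvu 6) (hvu 8)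
    (hne 6 8 (by decide))
  have hrange : ∀ r, G.Adj v r → ∃ i, u i = r := by
    have hsub : Set.range u ⊆ G.neighborSet v := by rintro _ ⟨i, rfl⟩; exact hnbr i
    have heq := Set.eq_of_subset_of_ncard_le hsub (by
      rw [hdeg, ← Set.image_univ, Set.ncard_image_of_injective _ hinj, Set.ncard_univ]; simp)
    intro r hr
    have : r ∈ Set.range u := heq ▸ hr
    exact this
  let B : Finset (Sym2 V) := {s(u 0, u 1), s(u 0, x), s(u 2, u 1), s(u 2, u 3), s(u 4, v),
    s(u 4, u 5), s(u 7, u 6), s(u 7, u 8)}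
  have hBG : (B : Set (Sym2 V)) ⊆ G.edgeSet := by
    intro e he
    simp only [B, Finset.coe_insert, Finset.coe_singleton, Set.mem_insert_iff,
      Set.mem_singleton_iff] at he
    rcases he with rfl | rfl | rfl | rfl | rfl | rfl | rfl | rfl
    exacts [p01, h0x, p12.symm, p23, (hnbr 4).symm, p45, p67.symm, p78]
  refine ⟨B, hBG, ?_, ?_⟩
  · exact (Finset.card_insert_le _ _).trans (Nat.succ_le_succ
      ((Finset.card_insert_le _ _).trans (Nat.succ_le_succ Finset.card_le_six)))
  obtain ⟨S, hS, hcard⟩ := (G.deleteEdges (B : Set (Sym2 V))).exists_isIndepDomSet_ncard_eq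
  have hadj : ∀ a b, (G.deleteEdges (B : Set (Sym2 V))).Adj a b ↔ G.Adj a b ∧ s(a, b) ∉ B :=
    fun a b => by rw [SimpleGraph.deleteEdges_adj, Finset.mem_coe]
  let T : Set V := {u 0, u 2, u 4, u 7}
  have hT : ∀ i ∉ ({0, 2, 4, 7} : Finset (Fin 9)), u i ∉ T := by
    intro i hi h
    simp only [T, Set.mem_insert_iff, Set.mem_singleton_iff, hinj.eq_iff] at h
    simp only [Finset.mem_insert, Finset.mem_singleton] at hi
    exact hi h
  suffices h : ∃ D, G.IsIndepDomSet D ∧ D.ncard < S.ncard by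
    obtain ⟨D, hD, hlt⟩ := h
    exact hcard ▸ (SimpleGraph.indepDomNum_le hD).trans_lt hlt
  refine SimpleGraph.exists_isIndepDomSet_ncard_lt (T := T) (v := v) (w := u 3)
    (b := u 2) (c := u 4) (G.deleteEdges_le _) ?_ ?_ (by simp [T]) (by simp [T])
    (hne 2 4 (by decide)) (by simp [T, hvu]) (hT 3 (by decide)) ?_ ?_ ?_ (hnbr 3) p23.symm p34
    ?_ hS
  · rintro _ (rfl | rfl | rfl | rfl) _ (rfl | rfl | rfl | rfl) <;>
      exact hind _ (by decide) _ (by decide)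
  · intro a ha b hb e
    refine (hadj a b).2 ⟨e, fun h => ?_⟩
    simp only [T, Set.mem_insert_iff, Set.mem_singleton_iff, not_or] at ha hb
    simp only [B, Finset.mem_insert, Finset.mem_singleton, Sym2.eq_iff] at h
    tauto
  · rintro t (rfl | rfl | rfl | rfl) htc y hy
    · obtain ⟨hG, hB⟩ := (hadj _ _).1 hy
      rcases n0 y hG with rfl | rfl | rfl
      exacts [rfl, absurd (by simp [B]) hB, absurd (by simp [B]) hB]
    · obtain ⟨hG, hB⟩ := (hadj _ _).1 hy
      rcases n2 y hG with rfl | rfl | rfl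
      exacts [rfl, absurd (by simp [B]) hB, absurd (by simp [B]) hB]
    · exact absurd rfl htc
    · obtain ⟨hG, hB⟩ := (hadj _ _).1 hy
      rcases n7 y hG with rfl | rfl | rfl
      exacts [rfl, absurd (by simp [B]) hB, absurd (by simp [B]) hB]
  · intro y hy
    obtain ⟨hG, hB⟩ := (hadj _ _).1 hy
    rcases n4 y hG with rfl | rfl | rfl
    exacts [absurd (by simp [B]) hB, rfl, absurd (by simp [B]) hB]
  · rintro t (rfl | rfl | rfl | rfl) <;> exact hnbr _
  · intro r hr e
    obtain ⟨i, rfl⟩ := hrange r e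
    fin_cases i
    · exact absurd (by simp [T]) hr
    · exact ⟨u 0, by simp [T], p01.symm⟩
    · exact absurd (by simp [T]) hr
    · exact ⟨u 2, by simp [T], p23.symm⟩
    · exact absurd (by simp [T]) hr
    · exact ⟨u 4, by simp [T], p45.symm⟩
    · exact ⟨u 7, by simp [T], p67⟩
    · exact absurd (by simp [T]) hr
    · exact ⟨u 7, by simp [T], p78.symm⟩
end

section
/- Let G be a finite simple graph containing a vertex v of degree 8 with distinct neighbors u_1, …, u_8 such that u_2 u_3, u_3 u_4, u_5 u_6, u_6 u_7, u_8 u_1 ∈ E(G) while u_1 u_2 ∉ E(G), u_4 u_5 ∉ E(G), and u_7 u_8 ∉ E(G). Suppose d(u_2) = d(u_4) = d(u_5) = d(u_7) = d(u_8) = 3 and {u_2, u_4, u_5, u_7, u_8} is an independent set in G. Then there exists a set B of at most 8 edges of G such that γ_i(G − B) > γ_i(G); that is, b_i(G) ≤ 8. -/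
open scoped BigOperators

/-- An independent set `A` dominating everything outside `U` extends to an independent dominating
set with at most `A.card + U.card` vertices. -/
theorem SimpleGraph.indepDomNum_le_card_add_card {V : Type*} (G : SimpleGraph V)
    (A U : Finset V) (hA : ∀ a ∈ A, ∀ b ∈ A, ¬ G.Adj a b)
    (hdom : ∀ x, x ∈ U ∨ x ∈ A ∨ ∃ a ∈ A, G.Adj a x) :
    G.indepDomNum ≤ A.card + U.card := by
  classical
  induction U using Finset.induction_on generalizing A with
  | empty =>
    refine Nat.sInf_le ⟨(A : Set V), ⟨by simpa using hA, fun x => ?_⟩, by simp⟩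
    simpa using hdom x
  | insert y U hy ih =>
    rw [Finset.card_insert_of_notMem hy]
    by_cases h : y ∈ A ∨ ∃ a ∈ A, G.Adj a y
    · have := ih A hA fun x => by
        rcases hdom x with hx | hx
        · rcases Finset.mem_insert.1 hx with rfl | hx
          · exact Or.inr h
          · exact Or.inl hx
        · exact Or.inr hx
      omega
    · push Not at h
      have := ih (insert y A)
        (fun a haM b hbM hab => by
          rcases Finset.mem_insert.1 haM with rfl | ha <;>
            rcases Finset.mem_insert.1 hbM with rfl | hb
          · exact hab.ne rfl
          · exact h.2 b hb hab.symm
          · exact h.2 a ha hab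
          · exact hA a ha b hb hab)
        (fun x => by
          rcases hdom x with hx | hx | ⟨a, ha, hx⟩
          · rcases Finset.mem_insert.1 hx with rfl | hx
            · simp
            · exact Or.inl hx
          · simp [hx]
          · exact Or.inr (Or.inr ⟨a, by simp [ha], hx⟩))
      rw [Finset.card_insert_of_notMem h.1] at this
      omega

theorem SimpleGraph.exists_isIndepDomSet_card_eq {V : Type*} [Fintype V] (G : SimpleGraph V) :
    ∃ S : Finset V, (∀ a ∈ S, ∀ b ∈ S, ¬ G.Adj a b) ∧
      (∀ x, x ∈ S ∨ ∃ a ∈ S, G.Adj a x) ∧ S.card = G.indepDomNum := by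
  classical
  have hne : {n | ∃ S : Set V, G.IsIndepDomSet S ∧ S.ncard = n}.Nonempty := by
    obtain ⟨M, hM⟩ := (Set.toFinite {S : Set V | ∀ a ∈ S, ∀ b ∈ S, ¬ G.Adj a b}).exists_maximal
      ⟨∅, by simp⟩
    refine ⟨_, M, ⟨hM.prop, fun x => ?_⟩, rfl⟩
    by_contra! hx
    refine hx.1 (hM.le_of_ge (y := insert x M) ?_ (Set.subset_insert _ _) (Set.mem_insert _ _))
    rintro a (rfl | ha) b (rfl | hb) hab
    · exact hab.ne rfl
    · exact hx.2 b hb hab.symm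
    · exact hx.2 a ha hab
    · exact hM.prop a ha b hb hab
  obtain ⟨S, hS, hcard⟩ := Nat.sInf_mem hne
  refine ⟨S.toFinset, by simpa using hS.1, by simpa using hS.2, ?_⟩
  rw [← Set.ncard_eq_toFinset_card']
  exact hcard

theorem Set.exists_third_of_ncard_eq_three {α : Type*} {s : Set α} (hs : s.ncard = 3) {a b : α}
    (ha : a ∈ s) (hb : b ∈ s) (hab : a ≠ b) : ∃ c, ∀ x ∈ s, x = a ∨ x = b ∨ x = c := by
  have hfin : s.Finite := Set.finite_of_ncard_ne_zero (by omega)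
  have hsub : ({a, b} : Set α) ⊆ s := by
    rintro x (rfl | rfl) <;> assumption
  have h1 : (s \ {a, b}).ncard = 1 := by
    rw [Set.ncard_sdiff hsub, hs, Set.ncard_pair hab]
  obtain ⟨c, hc⟩ := Set.ncard_eq_one.1 h1
  refine ⟨c, fun x hx => ?_⟩
  by_contra! h
  have : x ∈ s \ {a, b} := ⟨hx, by simp [h.1, h.2.1]⟩
  rw [hc] at this
  exact h.2.2 this

/-- The edges at `p`, together with the edges at `q` and `r` that avoid `v`. -/
noncomputable def SimpleGraph.tripleCut {V : Type*} [Fintype V] (G : SimpleGraph V)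
    (v p q r : V) : Finset (Sym2 V) :=
  open Classical in
  (G.neighborFinset p).image (fun y => s(p, y)) ∪
    ((G.neighborFinset q).erase v).image (fun y => s(q, y)) ∪
      ((G.neighborFinset r).erase v).image (fun y => s(r, y))

theorem SimpleGraph.tripleCut_subset {V : Type*} [Fintype V] (G : SimpleGraph V) (v p q r : V) :
    (G.tripleCut v p q r : Set (Sym2 V)) ⊆ G.edgeSet := by
  classical
  intro e he
  simp only [tripleCut, Finset.coe_union, Finset.coe_image, Set.mem_union, Set.mem_image,
    Finset.mem_coe, Finset.mem_erase, SimpleGraph.mem_neighborFinset] at he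
  rcases he with (⟨y, hy, rfl⟩ | ⟨y, hy, rfl⟩) | ⟨y, hy, rfl⟩
  · exact hy
  · exact hy.2
  · exact hy.2

theorem SimpleGraph.card_tripleCut_le {V : Type*} [Fintype V] (G : SimpleGraph V) {v p q r : V}
    (hq : G.Adj v q) (hr : G.Adj v r) (hp3 : (G.neighborSet p).ncard = 3)
    (hq3 : (G.neighborSet q).ncard = 3) (hr3 : (G.neighborSet r).ncard = 3) :
    (G.tripleCut v p q r).card ≤ 7 := by
  classical
  have hcard (x : V) : (G.neighborFinset x).card = (G.neighborSet x).ncard := by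
    rw [Set.ncard_eq_toFinset_card', SimpleGraph.neighborFinset]
  have hcq : ((G.neighborFinset q).erase v).card = 2 := by
    rw [Finset.card_erase_of_mem (by simpa using hq.symm), hcard, hq3]
  have hcr : ((G.neighborFinset r).erase v).card = 2 := by
    rw [Finset.card_erase_of_mem (by simpa using hr.symm), hcard, hr3]
  calc (G.tripleCut v p q r).card
      ≤ (G.neighborFinset p).card + ((G.neighborFinset q).erase v).card
          + ((G.neighborFinset r).erase v).card := by
        unfold tripleCut
        refine (Finset.card_union_le _ _).trans (add_le_add ?_ Finset.card_image_le)
        exact (Finset.card_union_le _ _).trans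
          (add_le_add Finset.card_image_le Finset.card_image_le)
    _ ≤ 7 := by rw [hcard, hp3, hcq, hcr]

theorem SimpleGraph.mem_tripleCut_of_adj {V : Type*} [Fintype V] {G : SimpleGraph V}
    {v p q r a b : V} (hab : G.Adj a b) :
    s(a, b) ∈ G.tripleCut v p q r ↔ (a = p ∨ b = p) ∨ (a = q ∧ b ≠ v ∨ b = q ∧ a ≠ v) ∨
      (a = r ∧ b ≠ v ∨ b = r ∧ a ≠ v) := by
  classical
  have := hab.symm
  simp only [tripleCut, Finset.mem_union, Finset.mem_image, Finset.mem_erase,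
    SimpleGraph.mem_neighborFinset, Sym2.eq_iff]
  grind

/-- If `p, q, r, w, z` are independent neighbours of `v` and every other neighbour of `v` is
adjacent to `p`, `q` or `r`, and if outside `N[v]` each of `w` and `z` has at most one neighbour,
then deleting all edges at `p`, `q`, `r` other than `vq` and `vr` increases the independent
domination number. -/
theorem SimpleGraph.indepDomNum_lt_deleteEdges_tripleCut {V : Type*} [Fintype V]
    (G : SimpleGraph V) {v p q r w z c d : V}
    (hp : G.Adj v p) (hq : G.Adj v q) (hr : G.Adj v r) (hw : G.Adj v w) (hz : G.Adj v z)
    (hpq : p ≠ q) (hpr : p ≠ r) (hqr : q ≠ r)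
    (hwT : w ≠ p ∧ w ≠ q ∧ w ≠ r) (hzT : z ≠ p ∧ z ≠ q ∧ z ≠ r)
    (hT : ∀ s ∈ ({p, q, r} : Set V), ∀ t ∈ ({p, q, r} : Set V), ¬ G.Adj s t)
    (hcover : ∀ y, G.Adj v y → y = p ∨ y = q ∨ y = r ∨ y = w ∨ y = z ∨
      G.Adj p y ∨ G.Adj q y ∨ G.Adj r y)
    (hwN : ∀ y, G.Adj w y → y = v ∨ G.Adj v y ∨ y = c)
    (hzN : ∀ y, G.Adj z y → y = v ∨ G.Adj v y ∨ y = d) :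
    G.indepDomNum < (G.deleteEdges ↑(G.tripleCut v p q r)).indepDomNum := by
  classical
  obtain ⟨S, hSi, hSd, hSc⟩ :=
    (G.deleteEdges ↑(G.tripleCut v p q r)).exists_isIndepDomSet_card_eq
  rw [← hSc]
  have hadj (a b : V) : (G.deleteEdges ↑(G.tripleCut v p q r)).Adj a b ↔
      G.Adj a b ∧ ¬ ((a = p ∨ b = p) ∨ (a = q ∧ b ≠ v ∨ b = q ∧ a ≠ v) ∨
        (a = r ∧ b ≠ v ∨ b = r ∧ a ≠ v)) := by
    rw [SimpleGraph.deleteEdges_adj, Finset.mem_coe]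
    exact and_congr_right fun h => not_congr (SimpleGraph.mem_tripleCut_of_adj h)
  simp only [hadj] at hSi hSd
  have hpS : p ∈ S := by
    rcases hSd p with h | ⟨a, -, h⟩
    · exact h
    · simp at h
  have hvp := hp.ne
  have hvq := hq.ne
  have hvr := hr.ne
  have hvw := hw.ne
  have hvz := hz.ne
  by_cases hv : v ∈ S
  · have h := G.indepDomNum_le_card_add_card (S.erase p) ∅ (by grind) (fun x => by
      by_cases hx : x = p
      · exact Or.inr (Or.inr ⟨v, by simp [hv, hvp], hx ▸ hp⟩)
      · rcases hSd x with h | ⟨a, ha, h⟩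
        · simp [hx, h]
        · exact Or.inr (Or.inr ⟨a, by grind, h.1⟩))
    have := Finset.card_erase_lt_of_mem hpS
    simp at h
    omega
  have hqS : q ∈ S := by
    rcases hSd q with h | ⟨a, ha, h⟩ <;> grind
  have hrS : r ∈ S := by
    rcases hSd r with h | ⟨a, ha, h⟩ <;> grind
  have hTS : ({p, q, r} : Finset V) ⊆ S := by grind
  have hTc : ({p, q, r} : Finset V).card = 3 := Finset.card_eq_three.2
    ⟨p, q, r, hpq, hpr, hqr, rfl⟩
  have hS3 : (S \ {p, q, r}).card + 3 = S.card := by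
    rw [← hTc]
    exact Finset.card_sdiff_add_card_eq_card hTS
  by_cases hvd : ∃ y ∈ S \ {p, q, r}, G.Adj y v
  · by_cases ht : ∃ t ∈ ({p, q, r} : Finset V), ∃ y ∈ S \ {p, q, r}, G.Adj y t
    · obtain ⟨t, ht, y, hy, hyt⟩ := ht
      have h := G.indepDomNum_le_card_add_card (S \ {p, q, r}) (({p, q, r} : Finset V).erase t)
        (by grind) (fun x => by
          by_cases hxt : x = t
          · exact Or.inr (Or.inr ⟨y, hy, hxt ▸ hyt⟩)
          by_cases hxT : x ∈ ({p, q, r} : Finset V)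
          · exact Or.inl (Finset.mem_erase.2 ⟨hxt, hxT⟩)
          by_cases hxv : x = v
          · exact Or.inr (Or.inr (hxv ▸ hvd))
          rcases hSd x with h | ⟨a, ha, h⟩
          · exact Or.inr (Or.inl (Finset.mem_sdiff.2 ⟨h, hxT⟩))
          · exact Or.inr (Or.inr ⟨a, by grind, h.1⟩))
      rw [Finset.card_erase_of_mem ht, hTc] at h
      omega
    · push Not at ht
      obtain ⟨y, hy, hyv⟩ := hvd
      have hsub : S \ {p, q, r, w, z} ⊆ (S \ {p, q, r}).erase y := by
        intro x hx
        have := hcover y hyv.symm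
        have := ht p (by simp) y hy
        have := ht q (by simp) y hy
        have := ht r (by simp) y hy
        grind [SimpleGraph.adj_comm]
      have hc := Finset.card_le_card hsub
      rw [Finset.card_erase_of_mem hy] at hc
      have hpos := Finset.card_pos.2 ⟨y, hy⟩
      have hno : ∀ x ∈ S \ {p, q, r, w, z}, ¬ G.Adj v x := by
        intro x hx hvx
        have hx' : x ∈ S \ {p, q, r} := by grind
        have := hcover x hvx
        have := ht p (by simp) x hx'
        have := ht q (by simp) x hx'
        have := ht r (by simp) x hx'
        grind [SimpleGraph.adj_comm]
      have h := G.indepDomNum_le_card_add_card (insert v (S \ {p, q, r, w, z})) {c, d}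
        (by
          intro a haM b hbM hab
          rcases Finset.mem_insert.1 haM with rfl | ha <;>
            rcases Finset.mem_insert.1 hbM with rfl | hb
          · exact hab.ne rfl
          · exact hno b hb hab
          · exact hno a ha hab.symm
          · grind) (fun x => by
          by_cases hxv : x = v
          · simp [hxv]
          by_cases hvx : G.Adj v x
          · exact Or.inr (Or.inr ⟨v, by simp, hvx⟩)
          rcases hSd x with h | ⟨a, ha, h⟩
          · refine Or.inr (Or.inl (Finset.mem_insert_of_mem (Finset.mem_sdiff.2 ⟨h, fun hx => hvx ?_⟩)))
            simp only [Finset.mem_insert, Finset.mem_singleton] at hx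
            rcases hx with rfl | rfl | rfl | rfl | rfl <;> assumption
          · by_cases haw : a = w
            · have := hwN x (haw ▸ h.1)
              grind
            by_cases haz : a = z
            · have := hzN x (haz ▸ h.1)
              grind
            exact Or.inr (Or.inr ⟨a, by grind, h.1⟩))
      have h1 := Finset.card_insert_le v (S \ {p, q, r, w, z})
      have h2 : ({c, d} : Finset V).card ≤ 2 := Finset.card_le_two
      omega
  · push Not at hvd
    have h := G.indepDomNum_le_card_add_card (insert v (S \ {p, q, r})) ∅
      (by
        intro a haM b hbM hab
        rcases Finset.mem_insert.1 haM with rfl | ha <;>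
          rcases Finset.mem_insert.1 hbM with rfl | hb
        · exact hab.ne rfl
        · exact hvd b hb hab.symm
        · exact hvd a ha hab
        · grind) (fun x => by
        by_cases hxv : x = v
        · simp [hxv]
        by_cases hxT : x ∈ ({p, q, r} : Finset V)
        · refine Or.inr (Or.inr ⟨v, by simp, ?_⟩)
          simp only [Finset.mem_insert, Finset.mem_singleton] at hxT
          rcases hxT with rfl | rfl | rfl <;> assumption
        rcases hSd x with h | ⟨a, ha, h⟩
        · exact Or.inr (Or.inl (by grind))
        · exact Or.inr (Or.inr ⟨a, by grind, h.1⟩))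
    have h1 := Finset.card_insert_le v (S \ {p, q, r})
    simp at h
    omega

theorem stmt12 {V : Type*} [Fintype V]
    (G : SimpleGraph V) (v : V) (u : Fin 8 → V)
    (hinj : Function.Injective u)
    (hdeg : (G.neighborSet v).ncard = 8)
    (hnbr : ∀ i, G.Adj v (u i))
    (he23 : G.Adj (u 1) (u 2)) (he34 : G.Adj (u 2) (u 3))
    (he56 : G.Adj (u 4) (u 5)) (he67 : G.Adj (u 5) (u 6))
    (he81 : G.Adj (u 7) (u 0))
    (hn12 : ¬ G.Adj (u 0) (u 1)) (hn45 : ¬ G.Adj (u 3) (u 4))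
    (hn78 : ¬ G.Adj (u 6) (u 7))
    (hd2 : (G.neighborSet (u 1)).ncard = 3)
    (hd4 : (G.neighborSet (u 3)).ncard = 3)
    (hd5 : (G.neighborSet (u 4)).ncard = 3)
    (hd7 : (G.neighborSet (u 6)).ncard = 3)
    (hd8 : (G.neighborSet (u 7)).ncard = 3)
    (hind : ∀ i ∈ ({1, 3, 4, 6, 7} : Finset (Fin 8)),
      ∀ j ∈ ({1, 3, 4, 6, 7} : Finset (Fin 8)), ¬ G.Adj (u i) (u j)) :
    ∃ B : Finset (Sym2 V), ↑B ⊆ G.edgeSet ∧ B.card ≤ 8 ∧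
      G.indepDomNum < (G.deleteEdges ↑B).indepDomNum := by
  have hrange : Set.range u = G.neighborSet v := by
    refine Set.eq_of_subset_of_ncard_le (by rintro _ ⟨i, rfl⟩; exact hnbr i) ?_ (Set.toFinite _)
    rw [hdeg, ← Set.image_univ, Set.ncard_image_of_injective _ hinj]
    simp
  obtain ⟨c, hc⟩ := Set.exists_third_of_ncard_eq_three hd4 (a := v) (b := u 2)
    (hnbr 3).symm he34.symm (hnbr 2).ne
  obtain ⟨d, hd⟩ := Set.exists_third_of_ncard_eq_three hd7 (a := v) (b := u 5)
    (hnbr 6).symm he67.symm (hnbr 5).ne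
  refine ⟨G.tripleCut v (u 1) (u 4) (u 7), G.tripleCut_subset _ _ _ _,
    (G.card_tripleCut_le (hnbr 4) (hnbr 7) hd2 hd5 hd8).trans (by omega),
    G.indepDomNum_lt_deleteEdges_tripleCut (w := u 3) (z := u 6) (c := c) (d := d)
      (hnbr 1) (hnbr 4) (hnbr 7) (hnbr 3) (hnbr 6)
      (hinj.ne (by decide)) (hinj.ne (by decide)) (hinj.ne (by decide))
      ⟨hinj.ne (by decide), hinj.ne (by decide), hinj.ne (by decide)⟩
      ⟨hinj.ne (by decide), hinj.ne (by decide), hinj.ne (by decide)⟩ ?_ ?_ ?_ ?_⟩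
  · rintro s (rfl | rfl | rfl) t (rfl | rfl | rfl) <;>
      exact hind _ (by decide) _ (by decide)
  · intro y hy
    obtain ⟨i, rfl⟩ : y ∈ Set.range u := hrange ▸ hy
    fin_cases i <;> simp [he23, he56, he81]
  · intro y hy
    rcases hc y hy with rfl | rfl | rfl <;> simp [hnbr]
  · intro y hy
    rcases hd y hy with rfl | rfl | rfl <;> simp [hnbr]
end
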